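/- Let γ > 0, α > −1, and 1 < q < ∞. There exist constants C₁, C₂ > 0 such that for all z, u, ζ ∈ 𝔹_n satisfying ϱ(z,ζ) > C₁ ϱ(u,ζ), one has (∫_{D(z,γ)} |(1−⟨w,u⟩)^{−(n+1+α)} − (1−⟨w,ζ⟩)^{−(n+1+α)}|^q dτ(w))^{1/q} ≤ C₂ ϱ(u,ζ)^{1/2} / ϱ(z,ζ)^{n+1+α+1/2}. -/

import Mathlib

open MeasureTheory Filter Topology
open scoped Classical ENNReal

noncomputable section

/-- `ℂⁿ` with the Euclidean norm. -/
abbrev En (n : ℕ) := EuclideanSpace ℂ (Fin n)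

instance (n : ℕ) : MeasurableSpace (En n) := borel _
instance (n : ℕ) : BorelSpace (En n) := ⟨rfl⟩

/-- The Lebesgue volume measure on `ℂⁿ`. -/
def vol (n : ℕ) : Measure (En n) := Measure.addHaar

/-- The open unit ball `𝔹ₙ` of `ℂⁿ`. -/
def uball (n : ℕ) : Set (En n) := Metric.ball 0 1

/-- The Hermitian pairing `⟨z,w⟩ = ∑ⱼ zⱼ * conj wⱼ`. -/
def herm {n : ℕ} (z w : En n) : ℂ := ∑ j, z j * (starRingEnd ℂ) (w j)

/-- The orthogonal projection `P_z w` onto the line spanned by `z`. -/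
def prj {n : ℕ} (z w : En n) : En n :=
  if z = 0 then 0 else (herm w z / herm z z) • z

/-- The Möbius automorphism `φ_z` of the unit ball. -/
def mobius {n : ℕ} (z w : En n) : En n :=
  ((1 : ℂ) / (1 - herm w z)) •
    (z - prj z w - ((Real.sqrt (1 - ‖z‖ ^ 2) : ℝ) : ℂ) • (w - prj z w))

/-- The Bergman metric `β(z,w)`. -/
def bmet {n : ℕ} (z w : En n) : ℝ :=
  (1 / 2) * Real.log ((1 + ‖mobius z w‖) / (1 - ‖mobius z w‖))

/-- The Bergman metric ball `D(z,γ)`. -/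
def Dball {n : ℕ} (z : En n) (γ : ℝ) : Set (En n) :=
  {w | w ∈ uball n ∧ bmet z w < γ}

/-- The normalizing constant `c_α`. -/
def cnorm (n : ℕ) (α : ℝ) : ℝ :=
  if -1 < α then Real.Gamma (n + α + 1) / (n.factorial * Real.Gamma (α + 1)) else 1

/-- The weighted measure `dv_α = c_α (1-|z|²)^α dv` on the unit ball. -/
def measA (n : ℕ) (α : ℝ) : Measure (En n) :=
  ((vol n).restrict (uball n)).withDensity
    (fun z => ENNReal.ofReal (cnorm n α * (1 - ‖z‖ ^ 2) ^ α))

/-- The invariant measure `dτ = (1-|z|²)^{-(n+1)} dv` on the unit ball. -/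
def measTau (n : ℕ) : Measure (En n) :=
  ((vol n).restrict (uball n)).withDensity
    (fun z => ENNReal.ofReal ((1 - ‖z‖ ^ 2) ^ (-((n : ℝ) + 1))))

/-- The Bergman space (quasi-)norm `‖f‖_{p,α}`, valued in `ℝ≥0∞`. -/
def apnorm (n : ℕ) (p α : ℝ) (f : En n → ℂ) : ℝ≥0∞ :=
  (∫⁻ z, ENNReal.ofReal (‖f z‖ ^ p) ∂measA n α) ^ (1 / p)

/-- The radial derivative `Rf(z) = ∑ z_k ∂f/∂z_k = Df(z)[z]`. -/
def radD {n : ℕ} (f : En n → ℂ) (z : En n) : ℂ := fderiv ℂ f z z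

/-- Iterated radial derivative `R^k f`. -/
def radIter {n : ℕ} : ℕ → (En n → ℂ) → En n → ℂ
  | 0, f => f
  | (k + 1), f => radD (radIter k f)

/-- The pseudo-metric `ϱ` on the unit ball. -/
def rho {n : ℕ} (z w : En n) : ℝ :=
  if z ≠ 0 ∧ w ≠ 0 then
    |‖z‖ - ‖w‖| + ‖1 - herm z w / ((‖z‖ : ℂ) * (‖w‖ : ℂ))‖
  else ‖z‖ + ‖w‖

/-- The weighted Bergman kernel `K_α(z,w) = (1-⟨z,w⟩)^{-(n+1+α)}`. -/
def bergKer {n : ℕ} (α : ℝ) (z w : En n) : ℂ :=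
  (1 - herm z w) ^ ((-(((n : ℝ) + 1 + α)) : ℂ))

noncomputable abbrev ip {E} [NormedAddCommGroup E] [InnerProductSpace ℂ E] (a b : E) : ℂ := inner ℂ b a

section
variable {E : Type*} [NormedAddCommGroup E] [InnerProductSpace ℂ E]
lemma ip_self (a : E) : ip a a = ((‖a‖^2 : ℝ) : ℂ) := by simp [ip, inner_self_eq_norm_sq_to_K]

lemma semiB_aux (w : E) (hw : ‖w‖ ≤ 1) : ∃ c : ℝ, ∀ a b : E,
   ip (a - ((c:ℂ) * ip a w) • w) (b - ((c:ℂ) * ip b w) • w) = ip a b - ip a w * ip w b := by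
  set s := Real.sqrt (1 - ‖w‖^2)
  have hs : s^2 = 1 - ‖w‖^2 := Real.sq_sqrt (by nlinarith [norm_nonneg w])
  have hs0 : 0 ≤ s := Real.sqrt_nonneg _
  refine ⟨1/(1+s), fun a b => ?_⟩
  have hc : 2 * (1/(1+s)) - (1/(1+s))^2 * ‖w‖^2 = 1 := by
    have : ‖w‖^2 = 1 - s^2 := by linarith
    rw [this]; field_simp; ring
  have hc' : (2 * ((1/(1+s) : ℝ):ℂ) - ((1/(1+s) : ℝ):ℂ)^2 * ((‖w‖^2 : ℝ) : ℂ)) = 1 := by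
    exact_mod_cast hc
  have hbw : ip w b = (starRingEnd ℂ) (ip b w) := (inner_conj_symm _ _).symm
  have h : ip (a - ((((1/(1+s) : ℝ):ℂ)) * ip a w) • w) (b - ((((1/(1+s) : ℝ):ℂ)) * ip b w) • w) = 
     ip a b - (2 * ((1/(1+s) : ℝ):ℂ) - ((1/(1+s) : ℝ):ℂ)^2 * ip w w) * (ip a w * ip w b) := by
    generalize (1/(1+s) : ℝ) = c
    simp only [ip, inner_sub_left, inner_sub_right, inner_smul_left, inner_smul_right, map_mul, Complex.conj_ofReal, inner_conj_symm]
    ring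
  rw [h, ip_self, hc', one_mul]

lemma ip_le (a b : E) : ‖ip a b‖ ≤ ‖a‖ * ‖b‖ := by
  rw [mul_comm]; exact norm_inner_le_norm _ _

lemma semiB (a b w : E) (hw : ‖w‖ ≤ 1) :
    ‖ip a b - ip a w * ip w b‖ ^ 2 ≤ (‖a‖^2 - ‖ip a w‖^2) * (‖b‖^2 - ‖ip b w‖^2) := by
  obtain ⟨c, hc⟩ := semiB_aux w hw
  have key : ∀ a : E, ‖a - ((c:ℂ) * ip a w) • w‖^2 = ‖a‖^2 - ‖ip a w‖^2 := by
    intro a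
    have h := hc a a
    have h2 : ip a w * ip w a = ((‖ip a w‖^2 : ℝ) : ℂ) := by
      have hbw : ip w a = (starRingEnd ℂ) (ip a w) := (inner_conj_symm _ _).symm
      rw [hbw, Complex.mul_conj, Complex.normSq_eq_norm_sq]
    rw [ip_self, ip_self, h2] at h
    exact_mod_cast h
  rw [← hc, ← key, ← key, ← mul_pow]
  gcongr
  exact ip_le _ _

lemma ip_comm_norm (a b : E) : ‖ip a b‖ = ‖ip b a‖ := norm_inner_symm _ _

lemma one_sub_ip_comm (a b : E) : ‖1 - ip a b‖ = ‖1 - ip b a‖ := by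
  have hbw : ip a b = (starRingEnd ℂ) (ip b a) := (inner_conj_symm _ _).symm
  rw [hbw, ← Complex.norm_conj]; simp

lemma one_sub_norm_le (x : ℂ) : 1 - ‖x‖ ≤ ‖1 - x‖ := by
  have := norm_sub_norm_le (1:ℂ) x; simpa using this

lemma one_sub_sq_le (x : ℂ) (hx : ‖x‖ ≤ 1) : 1 - ‖x‖^2 ≤ 2 * ‖1 - x‖ := by
  have := one_sub_norm_le x
  nlinarith [norm_nonneg x]

/-- lower bound of X -/
lemma lowX (a b : E) (ha : ‖a‖ ≤ 1) (hb : ‖b‖ ≤ 1) : 1 - ‖a‖^2 ≤ 2 * ‖1 - ip a b‖ := by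
  have h1 := one_sub_norm_le (ip a b)
  have h2 := ip_le a b
  nlinarith [norm_nonneg a, norm_nonneg b]

/-- sq of the triangle inequality -/
lemma tri (a b w : E) (ha : ‖a‖ ≤ 1) (hb : ‖b‖ ≤ 1) (hw : ‖w‖ ≤ 1) :
    ‖1 - ip a b‖ ≤ 2 * ‖1 - ip a w‖ + 2 * ‖1 - ip w b‖ := by
  have h := semiB a b w hw
  have hA : ‖ip a w‖ ≤ 1 := (ip_le a w).trans (mul_le_one₀ ha (norm_nonneg _) hw)
  have hB : ‖ip b w‖ ≤ 1 := (ip_le b w).trans (mul_le_one₀ hb (norm_nonneg _) hw)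
  have h1 := one_sub_sq_le _ hA
  have h2 := one_sub_sq_le _ hB
  rw [one_sub_ip_comm b w] at h2
  have ha2 : ‖a‖^2 ≤ 1 := by nlinarith [norm_nonneg a]
  have hb2 : ‖b‖^2 ≤ 1 := by nlinarith [norm_nonneg b]
  have h3 : ‖ip a b - ip a w * ip w b‖ ≤ ‖1 - ip a w‖ + ‖1 - ip w b‖ := by
    apply abs_le_of_sq_le_sq' _ (by positivity) |>.2
    calc _ ≤ _ := h
      _ ≤ (2 * ‖1 - ip a w‖) * (2 * ‖1 - ip w b‖) := by
        apply mul_le_mul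
        · linarith
        · linarith
        · nlinarith [ip_le b w, norm_nonneg b, norm_nonneg w, norm_nonneg (ip b w), mul_le_of_le_one_right (norm_nonneg b) hw]
        · positivity
      _ ≤ _ := by nlinarith [sq_nonneg (‖1 - ip a w‖ - ‖1 - ip w b‖)]
  have h4 : 1 - ip a b = (1 - ip a w) + ip a w * (1 - ip w b) - (ip a b - ip a w * ip w b) := by ring
  rw [h4]
  calc _ ≤ ‖1 - ip a w‖ + ‖ip a w * (1 - ip w b)‖ + ‖ip a b - ip a w * ip w b‖ := by
        refine (norm_sub_le _ _).trans ?_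
        gcongr; exact norm_add_le _ _
    _ ≤ ‖1 - ip a w‖ + 1 * ‖1 - ip w b‖ + (‖1 - ip a w‖ + ‖1 - ip w b‖) := by
        rw [norm_mul]; gcongr
    _ = _ := by ring

/-- `‖1-t‖ ≤ 2 ‖1 - r t‖` -/
lemma one_sub_scale (r : ℝ) (t : ℂ) (hr0 : 0 ≤ r) (hr : r ≤ 1) (ht : ‖t‖ ≤ 1) :
    ‖1 - t‖ ≤ 2 * ‖1 - r * t‖ := by
  have h1 := one_sub_norm_le (r * t)
  have h2 : ‖(r:ℂ) * t‖ = r * ‖t‖ := by rw [norm_mul, Complex.norm_real, Real.norm_of_nonneg hr0]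
  have h3 : 1 - t = (1 - r * t) - ((1 - r : ℝ) : ℂ) * t := by push_cast; ring
  have h4 : ‖((1 - r : ℝ) : ℂ) * t‖ = (1 - r) * ‖t‖ := by
    rw [norm_mul, Complex.norm_real, Real.norm_of_nonneg (by linarith)]
  rw [h3]
  refine (norm_sub_le _ _).trans ?_
  rw [h4]; nlinarith [norm_nonneg t]

/-- difference estimate, unit vectors -/
lemma diff_unit (w u ζ : E) (r s : ℝ) (hw : ‖w‖ ≤ 1) (hu : ‖u‖ = 1) (hz : ‖ζ‖ = 1)
    (hr0 : 0 ≤ s) (hs : s ≤ 1) :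
    ‖ip w ((r:ℂ) • u) - ip w ((s:ℂ) • ζ)‖ ≤ 2 * (|r - s| + ‖1 - ip u ζ‖) +
      2 * √(‖1 - ip w ((s:ℂ) • ζ)‖ * (|r - s| + ‖1 - ip u ζ‖)) := by
  set d := |r - s| + ‖1 - ip u ζ‖ with hd
  set X := ‖1 - ip w ((s:ℂ) • ζ)‖ with hX
  have e1 : ip w ((s:ℂ) • ζ) = s * ip w ζ := by simp [ip, inner_smul_left]
  have e2 : ip w ((r:ℂ) • u) = r * ip w u := by simp [ip, inner_smul_left]
  have hA : ‖ip w ζ‖ ≤ 1 := (ip_le w ζ).trans (mul_le_one₀ hw (norm_nonneg _) hz.le)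
  have hA' : ‖ip w u‖ ≤ 1 := (ip_le w u).trans (mul_le_one₀ hw (norm_nonneg _) hu.le)
  have hB : ‖ip u ζ‖ ≤ 1 := (ip_le u ζ).trans (mul_le_one₀ hu.le (norm_nonneg _) hz.le)
  have h := semiB w u ζ hz.le
  have h2 := one_sub_sq_le _ hB
  have hw2 : ‖w‖^2 ≤ 1 := by nlinarith [norm_nonneg w]
  have h1 : 1 - ‖ip w ζ‖^2 ≤ 2 * X := by
    have := one_sub_norm_le (s * ip w ζ)
    rw [norm_mul, Complex.norm_real, Real.norm_of_nonneg hr0, ← e1, ← hX] at this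
    nlinarith [norm_nonneg (ip w ζ)]
  have hX0 : 0 ≤ X := norm_nonneg _
  have hd0 : 0 ≤ d := by positivity
  have h3 : ‖ip w u - ip w ζ * ip ζ u‖ ≤ 2 * √(X * d) := by
    apply abs_le_of_sq_le_sq' _ (by positivity) |>.2
    rw [mul_pow, Real.sq_sqrt (by positivity)]
    calc _ ≤ _ := h
      _ ≤ (2 * X) * (2 * d) := by
        apply mul_le_mul
        · linarith
        · rw [hu]; linarith [abs_nonneg (r-s)]
        · rw [hu]; nlinarith [norm_nonneg (ip u ζ)]
        · positivity
      _ = _ := by ring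
  have h4 : ip w ((r:ℂ) • u) - ip w ((s:ℂ) • ζ) = ((r - s : ℝ):ℂ) * ip w u + 
     s * ((ip w u - ip w ζ * ip ζ u) - ip w ζ * (1 - ip ζ u)) := by rw [e1, e2]; push_cast; ring
  rw [h4]
  calc _ ≤ |r - s| * 1 + 1 * (2 * √(X * d) + 1 * ‖1 - ip u ζ‖) := by
        refine (norm_add_le _ _).trans ?_
        rw [norm_mul, norm_mul, Complex.norm_real, Complex.norm_real, Real.norm_of_nonneg hr0, Real.norm_eq_abs]
        gcongr
        refine (norm_sub_le _ _).trans ?_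
        rw [norm_mul, one_sub_ip_comm u ζ]
        gcongr
    _ ≤ _ := by linarith
end

/-- power estimate -/
lemma pow_diff (p : ℝ) (hp : 0 < p) (a b : ℂ) (ha : 0 < a.re) (hb : 0 < b.re)
    (hab : ‖a - b‖ ≤ ‖b‖ / 2) :
    ‖a ^ ((-p : ℝ) : ℂ) - b ^ ((-p : ℝ) : ℂ)‖ ≤ p * (‖b‖/2) ^ (-p-1) * ‖a - b‖ := by
  have hb0 : 0 < ‖b‖ := norm_pos_iff.2 (by rintro rfl; simp at hb)
  have hconv : Convex ℝ ({c : ℂ | 0 < c.re} ∩ Metric.closedBall b (‖b‖/2)) :=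
    (convex_halfSpace_re_gt 0).inter (convex_closedBall _ _)
  refine hconv.norm_image_sub_le_of_norm_hasDerivWithin_le (f := fun c : ℂ => c ^ ((-p : ℝ) : ℂ))
    (f' := fun c => ((-p : ℝ) : ℂ) * c ^ (((-p : ℝ) : ℂ) - 1)) ?_ ?_ ⟨hb, ?_⟩ ⟨ha, ?_⟩
  · rintro c ⟨hc, -⟩
    have := (hasDerivAt_id c).cpow_const (c := ((-p : ℝ) : ℂ)) (Or.inl hc)
    simpa using this.hasDerivWithinAt
  · rintro c ⟨hc, hc2⟩
    have : (((-p : ℝ) : ℂ) - 1) = ((-p - 1 : ℝ) : ℂ) := by push_cast; ring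
    rw [norm_mul, Complex.norm_real, this, Complex.norm_cpow_real, Real.norm_eq_abs, abs_neg, abs_of_pos hp]
    apply mul_le_mul_of_nonneg_left _ hp.le
    apply Real.rpow_le_rpow_of_nonpos (by positivity) _ (by linarith)
    rw [mem_closedBall_iff_norm] at hc2
    have := norm_sub_norm_le b c
    rw [norm_sub_rev] at this
    linarith
  · simp; positivity
  · rwa [mem_closedBall_iff_norm]

lemma herm_eq {n : ℕ} (z w : En n) : herm z w = ip z w := by
  simp [herm, ip, PiLp.inner_apply]

lemma mem_uball {n : ℕ} {z : En n} : z ∈ uball n ↔ ‖z‖ < 1 := by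
  simp [uball]

lemma rho_nonneg {n : ℕ} (z w : En n) : 0 ≤ rho z w := by
  unfold rho; split_ifs <;> positivity

lemma exists_unit {n : ℕ} (hn : 1 ≤ n) (z : En n) : ∃ e : En n, ‖e‖ = 1 ∧ z = (‖z‖ : ℂ) • e := by
  by_cases hz : z = 0
  · refine ⟨EuclideanSpace.single ⟨0, hn⟩ 1, by simp, by simp [hz]⟩
  · have h0 : (‖z‖ : ℂ) ≠ 0 := by simpa using hz
    refine ⟨(‖z‖ : ℂ)⁻¹ • z, ?_, ?_⟩
    · rw [norm_smul, norm_inv, Complex.norm_real, norm_norm, inv_mul_cancel₀ (norm_ne_zero_iff.2 hz)]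
    · rw [smul_smul, mul_inv_cancel₀ h0, one_smul]

lemma ip_smul_smul {n : ℕ} (r s : ℝ) (a b : En n) :
    ip ((r:ℂ) • a) ((s:ℂ) • b) = r * s * ip a b := by
  simp only [ip, inner_smul_left, inner_smul_right, Complex.conj_ofReal]; ring

lemma rho_form {n : ℕ} (z w e f : En n) (hz : z ≠ 0) (hw : w ≠ 0) (he : z = (‖z‖ : ℂ) • e)
    (hf : w = (‖w‖ : ℂ) • f) : rho z w = |‖z‖ - ‖w‖| + ‖1 - ip e f‖ := by
  rw [rho, if_pos ⟨hz, hw⟩, herm_eq]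
  have h : ip z w = ‖z‖ * ‖w‖ * ip e f := by
    rw [← ip_smul_smul, ← he, ← hf]
  have h1 : (‖z‖ : ℂ) ≠ 0 := by simpa using hz
  have h2 : (‖w‖ : ℂ) ≠ 0 := by simpa using hw
  rw [h, mul_div_cancel_left₀ _ (mul_ne_zero h1 h2)]

lemma rho_le {n : ℕ} (hn : 1 ≤ n) (z w : En n) (hz : ‖z‖ < 1) (hw : ‖w‖ < 1) :
    rho z w ≤ 3 * ‖1 - ip z w‖ := by
  by_cases h : z ≠ 0 ∧ w ≠ 0
  · obtain ⟨e, he1, he⟩ := exists_unit hn z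
    obtain ⟨f, hf1, hf⟩ := exists_unit hn w
    rw [rho_form z w e f h.1 h.2 he hf]
    have hh : ip z w = ((‖z‖ * ‖w‖ : ℝ) : ℂ) * ip e f := by
      push_cast
      rw [← ip_smul_smul, ← he, ← hf]
    have hef : ‖ip e f‖ ≤ 1 := (ip_le e f).trans (by rw [he1, hf1]; norm_num)
    have h1 := one_sub_scale (‖z‖ * ‖w‖) (ip e f) (by positivity)
      (mul_le_one₀ hz.le (norm_nonneg _) hw.le) hef
    rw [← hh] at h1
    have h2 := one_sub_norm_le (ip z w)
    have h3 := ip_le z w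
    have h4 : |‖z‖ - ‖w‖| ≤ 1 - ‖z‖ * ‖w‖ := by
      rw [abs_le]; constructor <;> nlinarith [norm_nonneg z, norm_nonneg w]
    linarith
  · rw [rho, if_neg h]
    have : z = 0 ∨ w = 0 := by tauto
    rcases this with rfl | rfl
    · simp [ip]; linarith
    · simp [ip]; linarith

lemma diff_rho {n : ℕ} (hn : 1 ≤ n) (w u ζ : En n) (hw : ‖w‖ < 1) (hu : ‖u‖ < 1) (hζ : ‖ζ‖ < 1) :
    ‖ip w u - ip w ζ‖ ≤ 2 * rho u ζ + 2 * √(‖1 - ip w ζ‖ * rho u ζ) := by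
  by_cases h : u ≠ 0 ∧ ζ ≠ 0
  · obtain ⟨e, he1, he⟩ := exists_unit hn u
    obtain ⟨f, hf1, hf⟩ := exists_unit hn ζ
    rw [rho_form u ζ e f h.1 h.2 he hf]
    have := diff_unit w e f ‖u‖ ‖ζ‖ hw.le he1 hf1 (norm_nonneg _) hζ.le
    rwa [← he, ← hf] at this
  · have h0 := rho_nonneg u ζ
    have h1 : ‖ip w u - ip w ζ‖ ≤ rho u ζ := by
      rw [rho, if_neg h]
      refine (norm_sub_le _ _).trans (add_le_add ?_ ?_)
      · exact (ip_le _ _).trans (mul_le_of_le_one_left (norm_nonneg _) hw.le)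
      · exact (ip_le _ _).trans (mul_le_of_le_one_left (norm_nonneg _) hw.le)
    have := Real.sqrt_nonneg (‖1 - ip w ζ‖ * rho u ζ)
    linarith

lemma mobius_id {n : ℕ} (hn : 1 ≤ n) (z w : En n) (hz : ‖z‖ < 1) (hw : ‖w‖ < 1) :
    ‖1 - ip w z‖ ^ 2 * (1 - ‖mobius z w‖ ^ 2) = (1 - ‖z‖ ^ 2) * (1 - ‖w‖ ^ 2) := by
  obtain ⟨e, he1, he⟩ := exists_unit hn z
  set r := ‖z‖ with hr
  set s := √(1 - r^2) with hs
  have hr0 : 0 ≤ r := norm_nonneg _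
  have hs2 : s^2 = 1 - r^2 := Real.sq_sqrt (by nlinarith)
  set N := z - prj z w - (s : ℂ) • (w - prj z w) with hN
  have hN2 : N = ((r:ℂ) - ip w e) • e - (s:ℂ) • (w - ip w e • e) := by
    by_cases h0 : z = 0
    · have hr0 : r = 0 := by simp [hr, h0]
      have hs1 : s = 1 := by simp [hs, hr0]
      rw [hN, prj, if_pos h0, hs1, hr0, h0]
      simp only [sub_zero, Complex.ofReal_one, one_smul, Complex.ofReal_zero, zero_sub, neg_smul]
      abel
    · have hrc : (r : ℂ) ≠ 0 := by simpa [hr] using h0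
      have hp : prj z w = ip w e • e := by
        rw [prj, if_neg h0, herm_eq, herm_eq, he]
        simp only [ip, inner_smul_left, inner_smul_right, Complex.conj_ofReal, smul_smul]
        rw [inner_self_eq_norm_sq_to_K, he1]
        congr 1
        field_simp
        simp
      rw [hN, hp, sub_smul, ← he]
  have hx : ip w z = r * ip w e := by
    rw [he]; simp [ip, inner_smul_left]
  have hpos : 0 < ‖1 - ip w z‖ := by
    have h1 := one_sub_norm_le (ip w z)
    have h2 := ip_le w z
    nlinarith [norm_nonneg z, norm_nonneg w]
  have hm : ‖mobius z w‖ = ‖N‖ / ‖1 - ip w z‖ := by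
    rw [mobius, norm_smul, herm_eq, norm_div, norm_one, ← hr, ← hs, ← hN]
    ring
  rw [hm, div_pow, mul_sub, mul_div_cancel₀ _ (by positivity), mul_one]
  have c1 : ((‖1 - ip w z‖ ^ 2 : ℝ) : ℂ) = (1 - r * ip w e) * (1 - r * ip e w) := by
    have hbw : ip e w = (starRingEnd ℂ) (ip w e) := (inner_conj_symm _ _).symm
    rw [← Complex.normSq_eq_norm_sq, ← Complex.mul_conj, hx, hbw]; simp
  have c2 : ((‖N‖ ^ 2 : ℝ) : ℂ) = ((r:ℂ) - ip w e) * (r - ip e w) + (s:ℂ)^2 * (ip w w - ip w e * ip e w) := by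
    have hee : inner ℂ e e = (1 : ℂ) := by rw [inner_self_eq_norm_sq_to_K, he1]; simp
    rw [← ip_self, hN2]
    simp only [ip, inner_sub_left, inner_sub_right, inner_smul_left, inner_smul_right, map_sub, Complex.conj_ofReal, inner_conj_symm, hee]
    ring
  have hs2' : (s:ℂ)^2 = 1 - (r:ℂ)^2 := by exact_mod_cast hs2
  have : ((‖1 - ip w z‖ ^ 2 - ‖N‖ ^ 2 : ℝ) : ℂ) = (((1 - r ^ 2) * (1 - ‖w‖ ^ 2) : ℝ) : ℂ) := by
    rw [Complex.ofReal_sub, c1, c2, hs2', ip_self]; push_cast; ring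
  exact_mod_cast this

/-- The enlarged measurable set. -/
def Eset {n : ℕ} (z : En n) (κ : ℝ) : Set (En n) :=
  {w | ‖w‖ < 1 ∧ κ * ‖1 - ip w z‖ ^ 2 ≤ (1 - ‖z‖ ^ 2) * (1 - ‖w‖ ^ 2)}

lemma Eset_meas {n : ℕ} (z : En n) (κ : ℝ) : MeasurableSet (Eset z κ) := by
  have h1 : MeasurableSet {w : En n | ‖w‖ < 1} :=
    (isOpen_lt continuous_norm continuous_const).measurableSet
  have h2 : MeasurableSet {w : En n | κ * ‖1 - ip w z‖ ^ 2 ≤ (1 - ‖z‖ ^ 2) * (1 - ‖w‖ ^ 2)} := by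
    refine (isClosed_le ?_ ?_).measurableSet
    · unfold ip; fun_prop
    · fun_prop
  exact h1.inter h2

lemma Dball_sub {n : ℕ} (hn : 1 ≤ n) (z : En n) (hz : ‖z‖ < 1) (γ : ℝ) :
    Dball z γ ⊆ Eset z (Real.exp (-(2 * γ))) := by
  rintro w ⟨hw, hb⟩
  rw [mem_uball] at hw
  refine ⟨hw, ?_⟩
  have h := mobius_id hn z w hz hw
  rw [bmet] at hb
  set m := ‖mobius z w‖ with hm
  have hm0 : 0 ≤ m := norm_nonneg _
  have hpz : 0 < 1 - ‖z‖^2 := by nlinarith [norm_nonneg z]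
  have hpw : 0 < 1 - ‖w‖^2 := by nlinarith [norm_nonneg w]
  have hpos : 0 < 1 - m^2 := by
    by_contra hc
    push Not at hc
    have := mul_nonpos_of_nonneg_of_nonpos (sq_nonneg ‖1 - ip w z‖) hc
    have := mul_pos hpz hpw
    linarith
  have hm1 : 0 < 1 - m := by nlinarith
  have h1 : (1 + m) / (1 - m) < Real.exp (2 * γ) := by
    rw [← Real.log_lt_iff_lt_exp (by positivity)]; linarith
  rw [div_lt_iff₀ hm1] at h1
  have h2 : Real.exp (-(2*γ)) ≤ 1 - m^2 := by
    have h3 : Real.exp (-(2*γ)) * Real.exp (2*γ) = 1 := by rw [← Real.exp_add]; simp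
    have h4 := Real.exp_pos (-(2*γ))
    nlinarith
  rw [← h, mul_comm]
  gcongr

lemma Eset_facts {n : ℕ} (z w : En n) (κ : ℝ) (hκ : 0 < κ) (hz : ‖z‖ < 1) (hw : w ∈ Eset z κ) :
    ‖1 - ip w z‖ ≤ 2 / κ * (1 - ‖w‖^2) ∧ ‖1 - ip w z‖ ≤ 2 / κ * (1 - ‖z‖^2) ∧
    κ / 4 * (1 - ‖z‖^2) ≤ 1 - ‖w‖^2 := by
  obtain ⟨hw1, hw2⟩ := hw
  have h1 := lowX w z hw1.le hz.le
  have h2 := lowX z w hz.le hw1.le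
  rw [one_sub_ip_comm] at h2
  set Y := ‖1 - ip w z‖
  have hpz : 0 < 1 - ‖z‖^2 := by nlinarith [norm_nonneg z]
  have hpw : 0 < 1 - ‖w‖^2 := by nlinarith [norm_nonneg w]
  set Z := 1 - ‖z‖^2
  set W := 1 - ‖w‖^2
  have hY : 0 < Y := by linarith
  have a1 : κ * Y ≤ 2 * W := by
    have : Y * (κ * Y) ≤ Y * (2 * W) := by nlinarith
    exact le_of_mul_le_mul_left this hY
  have a2 : κ * Y ≤ 2 * Z := by
    have : Y * (κ * Y) ≤ Y * (2 * Z) := by nlinarith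
    exact le_of_mul_le_mul_left this hY
  refine ⟨?_, ?_, ?_⟩
  · rw [div_mul_eq_mul_div, le_div_iff₀ hκ]; linarith
  · rw [div_mul_eq_mul_div, le_div_iff₀ hκ]; linarith
  · nlinarith

lemma vol_Eset {n : ℕ} (hn : 1 ≤ n) (z : En n) (κ : ℝ) (hκ : 0 < κ) (hz : ‖z‖ < 1) :
    vol n (Eset z κ) ≤ ENNReal.ofReal ((1 - ‖z‖^2) ^ (n+1)) *
      vol n (Metric.closedBall 0 (4 / κ + √(4 / κ))) := by
  obtain ⟨e, he1, he⟩ := exists_unit hn z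
  have hpz : 0 < 1 - ‖z‖^2 := by nlinarith [norm_nonneg z]
  set r := ‖z‖ with hr
  have hr0 : 0 ≤ r := norm_nonneg _
  set Z := 1 - r^2 with hZ
  set σ := √Z with hσ
  have hσ0 : 0 < σ := Real.sqrt_pos.2 hpz
  have hσ2 : σ^2 = Z := Real.sq_sqrt hpz.le
  have hσc : (σ:ℂ) ≠ 0 := by exact_mod_cast hσ0.ne'
  have hee : inner ℂ e e = (1 : ℂ) := by rw [inner_self_eq_norm_sq_to_K, he1]; simp
  let f : Module.Dual ℂ (En n) := ((σ:ℂ) - 1) • (innerSL ℂ e).toLinearMap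
  let T : En n →ₗ[ℂ] En n := (σ:ℂ) • LinearMap.transvection f e
  have hT : ∀ x, T x = (σ:ℂ) • (x + (((σ:ℂ) - 1) * inner ℂ e x) • e) := by
    intro x
    simp [T, f, LinearMap.transvection]
  have hdet : LinearMap.det T = ((σ^(n+1) : ℝ):ℂ) := by
    simp only [T, LinearMap.det_smul, LinearMap.transvection.det]
    simp [f, he1, pow_succ]
  have hdetR : |LinearMap.det (T.restrictScalars ℝ)| = Z^(n+1) := by
    rw [LinearMap.det_restrictScalars, hdet, Algebra.norm_complex_eq]
    change |Complex.normSq ((σ^(n+1) : ℝ):ℂ)| = _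
    rw [Complex.normSq_ofReal, ← hσ2, abs_of_nonneg (by positivity)]
    ring
  have : (vol n).IsAddHaarMeasure := by unfold vol; infer_instance
  have hsub : Eset z κ ⊆ (fun w => w + (-e)) ⁻¹'
      ((T.restrictScalars ℝ) '' (Metric.closedBall 0 (4 / κ + √(4 / κ)))) := by
    intro w hwE
    obtain ⟨f1, f2, f3⟩ := Eset_facts z w κ hκ hz hwE
    obtain ⟨hw1, -⟩ := hwE
    have hx : ip w z = r * ip w e := by
      rw [he]; simp [ip, inner_smul_left]
    set a := ip w e with ha
    have ha1 : ‖a‖ ≤ 1 := (ip_le w e).trans (by rw [he1]; linarith)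
    have hb : ‖1 - a‖ ≤ 4 / κ * Z := by
      have := one_sub_scale r a hr0 hz.le ha1
      rw [← hx] at this
      have e4 : 4 / κ * Z = 2 * (2 / κ * Z) := by ring
      rw [e4]; linarith
    have hperp : ‖w - a • e‖^2 ≤ 4 / κ * Z := by
      have h1 : ‖w - a • e‖^2 = ‖w‖^2 - ‖a‖^2 := by
        have : ((‖w - a • e‖^2 : ℝ) : ℂ) = ((‖w‖^2 - ‖a‖^2 : ℝ) : ℂ) := by
          rw [Complex.ofReal_sub, ← ip_self, ← ip_self, ← Complex.normSq_eq_norm_sq, ← Complex.mul_conj, ha]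
          simp only [ip, inner_sub_left, inner_sub_right, inner_smul_left, inner_smul_right, inner_conj_symm, hee]
          ring
        exact_mod_cast this
      have h2 := one_sub_norm_le (ip w z)
      rw [hx, norm_mul, Complex.norm_real, Real.norm_of_nonneg hr0, ← hx] at h2
      have e4 : 4 / κ * Z = 2 * (2 / κ * Z) := by ring
      rw [h1, e4]
      nlinarith [norm_nonneg a, norm_nonneg w]
    have hperp' : ‖w - a • e‖ ≤ √(4 / κ) * σ := by
      rw [hσ, ← Real.sqrt_mul (by positivity)]
      exact Real.le_sqrt_of_sq_le hperp
    refine ⟨(σ:ℂ)⁻¹ • (w - a • e) + ((σ:ℂ)⁻¹^2 * (a - 1)) • e, ?_, ?_⟩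
    · rw [mem_closedBall_zero_iff]
      refine (norm_add_le _ _).trans ?_
      rw [norm_smul, norm_smul, norm_mul, norm_pow, norm_inv, Complex.norm_real,
        Real.norm_of_nonneg hσ0.le, he1, norm_sub_rev a 1, inv_pow, hσ2, add_comm, mul_one]
      refine add_le_add ?_ ?_
      · rw [inv_mul_le_iff₀ hpz]; linarith
      · rw [inv_mul_le_iff₀ hσ0]; linarith
    · rw [LinearMap.restrictScalars_apply, hT]
      have hin : inner ℂ e ((σ:ℂ)⁻¹ • (w - a • e) + ((σ:ℂ)⁻¹^2 * (a - 1)) • e) = (σ:ℂ)⁻¹^2 * (a - 1) := by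
        simp only [inner_add_right, inner_sub_right, inner_smul_right, hee]
        change _ * (a - _) + _ = _
        ring
      rw [hin]
      have e1 : (σ:ℂ) * (σ:ℂ)⁻¹ = 1 := mul_inv_cancel₀ hσc
      have e2 : (σ:ℂ) * ((σ:ℂ)⁻¹^2 * (a - 1) + ((σ:ℂ) - 1) * ((σ:ℂ)⁻¹^2 * (a - 1))) = a - 1 := by
        field_simp; ring
      rw [add_assoc, ← add_smul, smul_add, smul_smul, smul_smul, e1, e2]
      module
  calc _ ≤ _ := measure_mono hsub
    _ = _ := by rw [measure_preimage_add_right, Measure.addHaar_image_linearMap, hdetR]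

lemma tau_Eset {n : ℕ} (hn : 1 ≤ n) (κ : ℝ) (hκ : 0 < κ) :
    ∃ V : ℝ, 0 < V ∧ ∀ z : En n, ‖z‖ < 1 → measTau n (Eset z κ) ≤ ENNReal.ofReal V := by
  have : (vol n).IsAddHaarMeasure := by unfold vol; infer_instance
  set B := vol n (Metric.closedBall (0 : En n) (4 / κ + √(4 / κ))) with hB
  have hBf : B ≠ ⊤ := (isCompact_closedBall _ _).measure_lt_top.ne
  refine ⟨(κ/4) ^ (-((n:ℝ)+1)) * B.toReal + 1, by positivity, fun z hz => ?_⟩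
  have hpz : 0 < 1 - ‖z‖^2 := by nlinarith [norm_nonneg z]
  rw [measTau, withDensity_apply _ (Eset_meas z κ)]
  calc _ ≤ ∫⁻ w in Eset z κ, ENNReal.ofReal ((κ / 4 * (1 - ‖z‖^2)) ^ (-((n:ℝ)+1))) ∂((vol n).restrict (uball n)) := by
        refine setLIntegral_mono' (Eset_meas z κ) fun w hw => ?_
        obtain ⟨f1, f2, f3⟩ := Eset_facts z w κ hκ hz hw
        apply ENNReal.ofReal_le_ofReal
        exact Real.rpow_le_rpow_of_nonpos (by positivity) f3 (by linarith [(Nat.cast_nonneg n : (0:ℝ) ≤ n)])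
    _ ≤ ENNReal.ofReal ((κ / 4 * (1 - ‖z‖^2)) ^ (-((n:ℝ)+1))) * vol n (Eset z κ) := by
        rw [setLIntegral_const]
        gcongr
        exact Measure.restrict_le_self
    _ ≤ ENNReal.ofReal ((κ / 4 * (1 - ‖z‖^2)) ^ (-((n:ℝ)+1))) * (ENNReal.ofReal ((1 - ‖z‖^2) ^ (n+1)) * ENNReal.ofReal B.toReal) := by
        rw [ENNReal.ofReal_toReal hBf]
        gcongr
        exact vol_Eset hn z κ hκ hz
    _ = ENNReal.ofReal ((κ/4) ^ (-((n:ℝ)+1)) * B.toReal) := by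
        rw [← ENNReal.ofReal_mul (by positivity), ← ENNReal.ofReal_mul (by positivity)]
        congr 1
        rw [Real.mul_rpow (by positivity) (by positivity)]
        have : (1 - ‖z‖^2) ^ (-((n:ℝ)+1)) * (1 - ‖z‖^2) ^ (n+1) = 1 := by
          rw [← Real.rpow_natCast _ (n+1), ← Real.rpow_add hpz]; push_cast; simp
        linear_combination ((κ/4) ^ (-((n:ℝ)+1)) * B.toReal) * this
    _ ≤ _ := ENNReal.ofReal_le_ofReal (by linarith)

lemma ptwise {n : ℕ} (hn : 1 ≤ n) (α κ : ℝ) (hα : -1 < α) (hκ : 0 < κ) (z u ζ w : En n)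
    (hz : ‖z‖ < 1) (hu : ‖u‖ < 1) (hζ : ‖ζ‖ < 1) (hw : w ∈ Eset z κ)
    (h : rho z ζ > 64 * (3 * (8 / κ + 2)) * rho u ζ) :
    ‖bergKer α w u - bergKer α w ζ‖ ≤ (3 * ((n:ℝ) + 1 + α) * 2 ^ ((n:ℝ) + 1 + α + 1) *
      (3 * (8 / κ + 2)) ^ ((n:ℝ) + 1 + α + 1/2)) *
        (rho u ζ ^ ((1:ℝ)/2) / rho z ζ ^ ((n:ℝ) + 1 + α + 1/2)) := by
  obtain ⟨f1, f2, f3⟩ := Eset_facts z w κ hκ hz hw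
  have hw1 : ‖w‖ < 1 := hw.1
  have hp : 0 < (n:ℝ) + 1 + α := by linarith [(Nat.cast_nonneg n : (0:ℝ) ≤ n)]
  have hker : ∀ v : En n, bergKer α w v = (1 - ip w v) ^ ((-((n:ℝ) + 1 + α) : ℝ) : ℂ) := by
    intro v; rw [bergKer, herm_eq]; push_cast; rfl
  rw [hker, hker]
  set p := (n:ℝ) + 1 + α with hpdef
  set A := 3 * (8 / κ + 2) with hA
  have hA0 : 0 < A := by positivity
  have hre : ∀ v : En n, ‖v‖ < 1 → 0 < (1 - ip w v).re := by
    intro v hv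
    have h1 := ip_le w v
    have h2 := Complex.re_le_norm (ip w v)
    rw [Complex.sub_re, Complex.one_re]
    nlinarith [norm_nonneg w, norm_nonneg v]
  have hd := diff_rho hn w u ζ hw1 hu hζ
  have hr := rho_le hn z ζ hz hζ
  have ht := tri z ζ w hz.le hζ.le hw1.le
  rw [one_sub_ip_comm z w] at ht
  have hl := lowX w ζ hw1.le hζ.le
  have hd0 := rho_nonneg u ζ
  set X := ‖1 - ip w ζ‖ with hX
  set d := rho u ζ with hdd
  set ρ := rho z ζ with hρ
  have hX0 : 0 < X := by nlinarith [norm_nonneg w]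
  have hρ0 : 0 < ρ := lt_of_le_of_lt (by positivity) h
  have hρX : ρ ≤ A * X := by
    have : 2 / κ * (1 - ‖w‖^2) ≤ 2 / κ * (2 * X) := by gcongr
    have e1 : A * X = 3 * (2 * (2 / κ * (2 * X)) + 2 * X) := by rw [hA]; ring
    rw [e1]; linarith
  have hdX : 64 * d ≤ X := by
    have : A * (64 * d) ≤ A * X := by linarith
    exact le_of_mul_le_mul_left this hA0
  have hsq : √(X * d) = √X * √d := Real.sqrt_mul hX0.le _
  have hsX : √X ^ 2 = X := Real.sq_sqrt hX0.le
  have hsd : √d ^ 2 = d := Real.sq_sqrt hd0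
  have hsXd : 8 * √d ≤ √X := by
    apply abs_le_of_sq_le_sq' _ (by positivity) |>.2
    rw [mul_pow, hsX, hsd]; linarith
  have hsd0 : 0 ≤ √d := Real.sqrt_nonneg _
  have hsX0 : 0 < √X := Real.sqrt_pos.2 hX0
  rw [hsq] at hd
  have hd1 : ‖ip w u - ip w ζ‖ ≤ 3 * (√X * √d) := by nlinarith
  have hd2 : ‖ip w u - ip w ζ‖ ≤ X / 2 := by nlinarith
  have hab : (1 - ip w u) - (1 - ip w ζ) = -(ip w u - ip w ζ) := by ring
  have key := pow_diff p hp (1 - ip w u) (1 - ip w ζ) (hre u hu) (hre ζ hζ) (by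
    rw [hab, norm_neg]; exact hd2)
  rw [hab, norm_neg, ← hX] at key
  have e1 : (X / 2) ^ (-p - 1) * √X = 2 ^ (p + 1) * X ^ (-(p + 1/2)) := by
    rw [Real.div_rpow hX0.le (by norm_num), Real.sqrt_eq_rpow, div_mul_eq_mul_div, ← Real.rpow_add hX0,
      show -p - 1 + 1/2 = -(p + 1/2) by ring, show -p - 1 = -(p+1) by ring, Real.rpow_neg (by norm_num : (0:ℝ) ≤ 2)]
    field_simp
  have e2 : X ^ (-(p + 1/2)) ≤ A ^ (p + 1/2) / ρ ^ (p + 1/2) := by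
    calc X ^ (-(p + 1/2)) ≤ (ρ / A) ^ (-(p+1/2)) := by
          apply Real.rpow_le_rpow_of_nonpos (by positivity) _ (by linarith)
          rw [div_le_iff₀ hA0]; linarith
      _ = _ := by
          rw [Real.rpow_neg (by positivity), Real.div_rpow hρ0.le hA0.le, inv_div]
  calc _ ≤ _ := key
    _ ≤ p * (X / 2) ^ (-p - 1) * (3 * (√X * √d)) := by gcongr
    _ = 3 * p * √d * ((X / 2) ^ (-p - 1) * √X) := by ring
    _ = 3 * p * √d * (2 ^ (p + 1) * X ^ (-(p + 1/2))) := by rw [e1]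
    _ ≤ 3 * p * √d * (2 ^ (p + 1) * (A ^ (p + 1/2) / ρ ^ (p + 1/2))) := by gcongr
    _ = _ := by rw [Real.sqrt_eq_rpow]; ring

/-- Smoothness estimate for the tent kernel: for `ϱ(z,ζ) > C₁ ϱ(u,ζ)`,
`(∫_{D(z,γ)} |K_α(w,u) - K_α(w,ζ)|^q dτ(w))^{1/q} ≤ C₂ ϱ(u,ζ)^{1/2} / ϱ(z,ζ)^{n+1+α+1/2}`. -/
theorem stmt17 (n : ℕ) (hn : 1 ≤ n) (γ α q : ℝ) (hγ : 0 < γ) (hα : -1 < α) (hq : 1 < q) :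
    ∃ C₁ C₂ : ℝ, 0 < C₁ ∧ 0 < C₂ ∧
      ∀ z ∈ uball n, ∀ u ∈ uball n, ∀ ζ ∈ uball n, rho z ζ > C₁ * rho u ζ →
        (∫⁻ w in Dball z γ,
            ENNReal.ofReal (‖bergKer α w u - bergKer α w ζ‖ ^ q) ∂measTau n) ^ (1 / q) ≤
          ENNReal.ofReal
            (C₂ * rho u ζ ^ ((1 : ℝ) / 2) / rho z ζ ^ ((n : ℝ) + 1 + α + 1 / 2)) := by
  set κ := Real.exp (-(2 * γ)) with hκd
  have hκ : 0 < κ := Real.exp_pos _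
  obtain ⟨V, hV, hVb⟩ := tau_Eset hn κ hκ
  have hp : 0 < (n:ℝ) + 1 + α := by linarith [(Nat.cast_nonneg n : (0:ℝ) ≤ n)]
  have hq0 : 0 < q := by linarith
  set K := 3 * ((n:ℝ) + 1 + α) * 2 ^ ((n:ℝ) + 1 + α + 1) *
      (3 * (8 / κ + 2)) ^ ((n:ℝ) + 1 + α + 1/2) with hK
  have hK0 : 0 < K := by positivity
  refine ⟨64 * (3 * (8 / κ + 2)), K * V ^ (1/q), by positivity, by positivity, ?_⟩
  intro z hz u hu ζ hζ h
  rw [mem_uball] at hz hu hζ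
  have hd0 := rho_nonneg u ζ
  have hρ0 := rho_nonneg z ζ
  set M := K * (rho u ζ ^ ((1:ℝ)/2) / rho z ζ ^ ((n:ℝ) + 1 + α + 1/2)) with hM
  have hM0 : 0 ≤ M := by positivity
  calc _ ≤ (ENNReal.ofReal (M ^ q * V)) ^ (1 / q) := by
        apply ENNReal.rpow_le_rpow _ (by positivity)
        calc _ ≤ ∫⁻ w in Eset z κ, ENNReal.ofReal (‖bergKer α w u - bergKer α w ζ‖ ^ q) ∂measTau n :=
              lintegral_mono_set (Dball_sub hn z hz γ)
          _ ≤ ∫⁻ _ in Eset z κ, ENNReal.ofReal (M ^ q) ∂measTau n := by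
              refine setLIntegral_mono' (Eset_meas z κ) fun w hw => ?_
              apply ENNReal.ofReal_le_ofReal
              exact Real.rpow_le_rpow (norm_nonneg _) (ptwise hn α κ hα hκ z u ζ w hz hu hζ hw h) hq0.le
          _ = ENNReal.ofReal (M ^ q) * measTau n (Eset z κ) := by rw [setLIntegral_const]
          _ ≤ ENNReal.ofReal (M ^ q) * ENNReal.ofReal V := by
              gcongr
              exact hVb z hz
          _ = _ := by rw [← ENNReal.ofReal_mul (by positivity)]
    _ = ENNReal.ofReal (M * V ^ (1/q)) := by
        rw [ENNReal.ofReal_rpow_of_nonneg (by positivity) (by positivity), Real.mul_rpow (by positivity) hV.le,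
          ← Real.rpow_mul hM0, mul_one_div_cancel hq0.ne', Real.rpow_one]
    _ = _ := by
        congr 1
        rw [hM]; ring
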